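/- Let ε > 0 and let p⁰ be a computation-register state on Fin 2^n with p^{t+1} = PPA(p^t) for all t ∈ ℕ. Then the sequence t ↦ p^t_0 (the first diagonal element) is monotonically non-decreasing and bounded above by 1; consequently the limit p^∞_0 = lim_{t→∞} p^t_0 exists. -/

import Mathlib

open Real Filter

/-- The multiset of `2^(n+1)` joint probabilities `p i * e^±ε / z`,
sorted in decreasing order (as a list, largest first):
entry `j` of this list is `λ_{j+1}` in the 1-indexed notation of the paper. -/
noncomputable def ppaSorted (n : ℕ) (ε : ℝ) (p : Fin (2^n) → ℝ) : List ℝ :=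
  ((((Finset.univ : Finset (Fin (2^n))).val.map
      fun j => p j * Real.exp ε / (Real.exp ε + Real.exp (-ε))) +
    ((Finset.univ : Finset (Fin (2^n))).val.map
      fun j => p j * Real.exp (-ε) / (Real.exp ε + Real.exp (-ε)))).sort (· ≤ ·)).reverse

/-- One iteration of the Partner Pairing Algorithm with a reset qubit of
polarization ε: `p'_i = λ_{2i+1} + λ_{2i+2}` (1-indexed) of the sorted joint probabilities. -/
noncomputable def PPA (n : ℕ) (ε : ℝ) (p : Fin (2^n) → ℝ) : Fin (2^n) → ℝ :=
  fun i => (ppaSorted n ε p).getD (2 * (i : ℕ)) 0 + (ppaSorted n ε p).getD (2 * (i : ℕ) + 1) 0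

/-- A computation-register state: strictly positive entries, sorted in
decreasing order, summing to 1. -/
def IsCompState (n : ℕ) (p : Fin (2^n) → ℝ) : Prop :=
  (∀ i, 0 < p i) ∧ Antitone p ∧ ∑ i, p i = 1

/-- The sum of two entries of a decreasing list is at most the sum of its first two entries. -/
theorem List.Pairwise.add_le_getD_zero_add_getD_one {l : List ℝ} (hl : l.Pairwise (· ≥ ·))
    {a b : ℝ} (hab : [a, b].Subperm l) : a + b ≤ l.getD 0 0 + l.getD 1 0 := by
  obtain ⟨l', hperm, hsub⟩ := hab
  have hsum : l'.sum = a + b := by simpa using hperm.sum_eq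
  have hlen : l'.length = 2 := by simpa using hperm.length_eq
  obtain ⟨c, d, rfl⟩ := List.length_eq_two.mp hlen
  rw [← hsum]
  match l, hl, hsub with
  | [x], _, hsub => simpa using hsub.length_le
  | x :: y :: t, hl, hsub =>
    have hc : c ≤ x := by
      have hmem : c ∈ x :: y :: t := hsub.subset (by simp)
      rcases List.mem_cons.mp hmem with h | h
      · exact h.le
      · exact List.rel_of_pairwise_cons hl h
    have hd : d ≤ y := by
      have hmem : d ∈ y :: t := hsub.tail.subset (by simp)
      rcases List.mem_cons.mp hmem with h | h
      · exact h.le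
      · exact List.rel_of_pairwise_cons hl.of_cons h
    simpa using add_le_add hc hd

theorem List.sum_range_getD_pairs (k : ℕ) (l : List ℝ) (hl : l.length = 2 * k) :
    ∑ i ∈ Finset.range k, (l.getD (2 * i) 0 + l.getD (2 * i + 1) 0) = l.sum := by
  induction k generalizing l with
  | zero => simp [List.length_eq_zero_iff.mp (by simpa using hl)]
  | succ k ih =>
    match l, hl with
    | [_], hl => simp at hl; omega
    | x :: y :: t, hl =>
      have ht : t.length = 2 * k := by simp at hl; omega
      rw [Finset.sum_range_succ']
      simp only [Nat.mul_add, Nat.mul_one, List.getD_cons_succ, mul_zero, List.getD_cons_zero,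
        zero_add, List.sum_cons, ih t ht]
      ring

theorem coe_ppaSorted (n : ℕ) (ε : ℝ) (p : Fin (2 ^ n) → ℝ) :
    (ppaSorted n ε p : Multiset ℝ) =
      (Finset.univ : Finset (Fin (2 ^ n))).val.map
        (fun j => p j * Real.exp ε / (Real.exp ε + Real.exp (-ε))) +
      (Finset.univ : Finset (Fin (2 ^ n))).val.map
        (fun j => p j * Real.exp (-ε) / (Real.exp ε + Real.exp (-ε))) := by
  rw [ppaSorted, Multiset.coe_reverse, Multiset.sort_eq]

theorem ppaSorted_pairwise (n : ℕ) (ε : ℝ) (p : Fin (2 ^ n) → ℝ) :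
    (ppaSorted n ε p).Pairwise (· ≥ ·) := by
  rw [ppaSorted, List.pairwise_reverse]
  exact Multiset.pairwise_sort _ _

theorem mul_exp_div_add_mul_exp_neg_div (ε x : ℝ) :
    x * Real.exp ε / (Real.exp ε + Real.exp (-ε)) +
      x * Real.exp (-ε) / (Real.exp ε + Real.exp (-ε)) = x := by
  have := Real.exp_pos ε
  have := Real.exp_pos (-ε)
  field_simp

theorem le_PPA_zero (n : ℕ) (ε : ℝ) (p : Fin (2 ^ n) → ℝ) (j : Fin (2 ^ n)) :
    p j ≤ PPA n ε p ⟨0, Nat.two_pow_pos n⟩ := by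
  have hsub : [p j * Real.exp ε / (Real.exp ε + Real.exp (-ε)),
      p j * Real.exp (-ε) / (Real.exp ε + Real.exp (-ε))].Subperm (ppaSorted n ε p) := by
    rw [← Multiset.coe_le, coe_ppaSorted]
    refine add_le_add (a := {_}) (c := {_}) ?_ ?_ <;>
      exact Multiset.singleton_le.mpr (Multiset.mem_map_of_mem _ (Finset.mem_univ j))
  simpa only [mul_exp_div_add_mul_exp_neg_div, PPA, mul_zero, zero_add] using
    (ppaSorted_pairwise n ε p).add_le_getD_zero_add_getD_one hsub

theorem PPA_nonneg (n : ℕ) (ε : ℝ) {p : Fin (2 ^ n) → ℝ} (hp : ∀ i, 0 ≤ p i) (i : Fin (2 ^ n)) :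
    0 ≤ PPA n ε p i := by
  have hmem : ∀ x ∈ ppaSorted n ε p, 0 ≤ x := by
    intro x hx
    rw [← Multiset.mem_coe, coe_ppaSorted, Multiset.mem_add, Multiset.mem_map,
      Multiset.mem_map] at hx
    rcases hx with ⟨j, -, rfl⟩ | ⟨j, -, rfl⟩ <;>
    · have := hp j
      positivity
  have hget : ∀ k, 0 ≤ (ppaSorted n ε p).getD k 0 := by
    intro k
    by_cases hk : k < (ppaSorted n ε p).length
    · rw [List.getD_eq_getElem _ _ hk]
      exact hmem _ (List.getElem_mem hk)
    · rw [List.getD_eq_default _ _ (not_lt.mp hk)]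
  exact add_nonneg (hget _) (hget _)

theorem sum_PPA (n : ℕ) (ε : ℝ) (p : Fin (2 ^ n) → ℝ) : ∑ i, PPA n ε p i = ∑ i, p i := by
  have hlen : (ppaSorted n ε p).length = 2 * 2 ^ n := by
    rw [← Multiset.coe_card, coe_ppaSorted]
    simp [two_mul]
  have hsum : (ppaSorted n ε p).sum = ∑ i, p i := by
    rw [← Multiset.sum_coe, coe_ppaSorted, Multiset.sum_add, Finset.sum_map_val,
      Finset.sum_map_val, ← Finset.sum_add_distrib]
    simp only [mul_exp_div_add_mul_exp_neg_div]
  rw [← hsum, ← List.sum_range_getD_pairs _ _ hlen]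
  exact Fin.sum_univ_eq_sum_range
    (fun i => (ppaSorted n ε p).getD (2 * i) 0 + (ppaSorted n ε p).getD (2 * i + 1) 0) (2 ^ n)

/-- the sequence `t ↦ p^t_0` is monotonically non-decreasing and
bounded above by 1, hence converges to some limit `p^∞_0`. -/
theorem ppa_p0_converges (n : ℕ) (hn : 1 ≤ n) (ε : ℝ) (hε : 0 < ε)
    (p : ℕ → Fin (2^n) → ℝ) (h0 : IsCompState n (p 0))
    (hstep : ∀ t, p (t + 1) = PPA n ε (p t)) :
    Monotone (fun t => p t ⟨0, Nat.two_pow_pos n⟩) ∧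
    (∀ t, p t ⟨0, Nat.two_pow_pos n⟩ ≤ 1) ∧
    ∃ L : ℝ, Tendsto (fun t => p t ⟨0, Nat.two_pow_pos n⟩) atTop (nhds L) := by
  have hinv : ∀ t, (∀ i, 0 ≤ p t i) ∧ ∑ i, p t i = 1 := by
    intro t
    induction t with
    | zero => exact ⟨fun i => (h0.1 i).le, h0.2.2⟩
    | succ t ih =>
      rw [hstep]
      exact ⟨PPA_nonneg n ε ih.1, (sum_PPA n ε (p t)).trans ih.2⟩
  have hmono : Monotone (fun t => p t ⟨0, Nat.two_pow_pos n⟩) := by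
    refine monotone_nat_of_le_succ fun t => ?_
    rw [hstep]
    exact le_PPA_zero n ε (p t) _
  have hbound : ∀ t, p t ⟨0, Nat.two_pow_pos n⟩ ≤ 1 := fun t =>
    (hinv t).2 ▸ Finset.single_le_sum (fun i _ => (hinv t).1 i) (Finset.mem_univ _)
  exact ⟨hmono, hbound, _, tendsto_atTop_ciSup hmono ⟨1, Set.forall_mem_range.mpr hbound⟩⟩
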